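/- Let S be a 3-CNF formula over n variables with q ≥ 1 clauses, and let N_S : (Fin n → ℝ) → ℝ be the associated gadget function. If no assignment b : Fin n → Bool satisfies S, then N_S x = 0 for every x : Fin n → ℝ with 0 ≤ x i ≤ 1 for all i. -/

import Mathlib

/-- An assignment `b` satisfies the 3-CNF formula `S` if every clause contains
a literal made true by `b`. -/
def Satisfies {n q : ℕ} (S : Fin q → Fin 3 → Fin n × Bool) (b : Fin n → Bool) : Prop :=
  ∀ j : Fin q, ∃ t : Fin 3, b (S j t).1 = (S j t).2

/-- The clamp gadget `f t = ReLU (ReLU t − ReLU (t−1))`. -/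
noncomputable def clampGadget (t : ℝ) : ℝ := max (max t 0 - max (t - 1) 0) 0

/-- The literal gadget: value of the `t`-th literal of clause `j` at input `x`. -/
noncomputable def litVal {n q : ℕ} (S : Fin q → Fin 3 → Fin n × Bool)
    (j : Fin q) (t : Fin 3) (x : Fin n → ℝ) : ℝ :=
  if (S j t).2 = true then clampGadget (2 * x (S j t).1 - 1)
  else clampGadget (1 - 2 * x (S j t).1)

/-- The clause gadget: value of clause `j` at input `x`. -/
noncomputable def clauseVal {n q : ℕ} (S : Fin q → Fin 3 → Fin n × Bool)
    (j : Fin q) (x : Fin n → ℝ) : ℝ :=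
  clampGadget (litVal S j 0 x + litVal S j 1 x + litVal S j 2 x)

/-- The gadget network `N_S` associated to the 3-CNF formula `S`. -/
noncomputable def gadgetNet {n q : ℕ} (S : Fin q → Fin 3 → Fin n × Bool)
    (x : Fin n → ℝ) : ℝ :=
  max ((∑ j, clauseVal S j x) - ((q : ℝ) - 1)) 0

theorem clampGadget_of_nonpos {t : ℝ} (h : t ≤ 0) : clampGadget t = 0 := by
  unfold clampGadget
  rw [max_eq_right h, max_eq_right (by linarith : t - 1 ≤ 0)]
  simp

theorem clampGadget_le_one (t : ℝ) : clampGadget t ≤ 1 := by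
  unfold clampGadget
  refine max_le ?_ zero_le_one
  have h1 := le_max_left (t - 1) 0
  have h2 := le_max_right (t - 1) 0
  have h3 : max t 0 ≤ 1 + max (t - 1) 0 := max_le (by linarith) (by linarith)
  linarith

/-- If the 3-CNF formula `S` is unsatisfiable, then the gadget network
vanishes identically on the unit cube. -/
theorem gadgetNet_eq_zero_of_unsat (n q : ℕ) (hq : 1 ≤ q)
    (S : Fin q → Fin 3 → Fin n × Bool)
    (hunsat : ¬ ∃ b : Fin n → Bool, Satisfies S b) :
    ∀ x : Fin n → ℝ, (∀ i, 0 ≤ x i ∧ x i ≤ 1) → gadgetNet S x = 0 := by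
  intro x _
  have hb : ¬ Satisfies S (fun i => decide (1 / 2 < x i)) := fun h => hunsat ⟨_, h⟩
  unfold Satisfies at hb
  push Not at hb
  obtain ⟨j, hj⟩ := hb
  have hl : ∀ t, litVal S j t x = 0 := by
    intro t
    have ht := hj t
    unfold litVal
    split_ifs with hs
    · rw [hs] at ht
      apply clampGadget_of_nonpos
      simp only [ne_eq, decide_eq_true_eq, not_lt] at ht
      linarith
    · rw [Bool.not_eq_true] at hs
      rw [hs] at ht
      apply clampGadget_of_nonpos
      simp only [ne_eq, decide_eq_false_iff_not, not_not] at ht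
      linarith
  have hc : clauseVal S j x = 0 := by
    unfold clauseVal
    rw [hl, hl, hl]
    exact clampGadget_of_nonpos (by norm_num)
  have hsum : ∑ k, clauseVal S k x ≤ ∑ k : Fin q, (if k = j then (0 : ℝ) else 1) := by
    apply Finset.sum_le_sum
    intro k _
    split_ifs with hk
    · rw [hk, hc]
    · exact clampGadget_le_one _
  have hcount : ∑ k : Fin q, (if k = j then (0 : ℝ) else 1) = (q : ℝ) - 1 := by
    have h1 : ∀ k : Fin q, (if k = j then (0 : ℝ) else 1) = 1 - (if k = j then 1 else 0) := by
      intro k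
      split_ifs <;> norm_num
    simp only [h1, Finset.sum_sub_distrib]
    simp
  unfold gadgetNet
  exact max_eq_right (by linarith)
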